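/- arXiv:2411.09144 — 7 statements merged into one kernel-verified Lean document; each statement's English description precedes it below -/
import Mathlib

section
/- Let M and P be locally compact second countable metrizable spaces, each equipped with a continuous action of SL(2,ℝ). Let λ be an SL(2,ℝ)-invariant Borel probability measure on M, and let (μ_i)_{i=1}^∞ be a sequence of SL(2,ℝ)-invariant Borel probability measures on M converging to λ in the weak-* topology. Let π : P → M be a continuous, proper, SL(2,ℝ)-equivariant map, and for each i let φ_i : M → P be a Borel map such that π ∘ φ_i = id_M holds μ_i-almost everywhere and φ_i(g.x) = g.φ_i(x) for every g ∈ SL(2,ℝ) and μ_i-almost every x. Then there exists an SL(2,ℝ)-invariant Borel probability measure on P whose pushforward under π equals λ. (Equivalently, if no SL(2,ℝ)-invariant probability measure on P projects to λ, such data cannot exist; this is the 'impossible section method'.) -/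
open MeasureTheory Filter

/-- `SL(2,ℝ)`. -/
abbrev SL2R := Matrix.SpecialLinearGroup (Fin 2) ℝ

/-- The natural (subtype) topology on `SL(2,ℝ)`. -/
instance : TopologicalSpace SL2R :=
  inferInstanceAs (TopologicalSpace {A : Matrix (Fin 2) (Fin 2) ℝ // A.det = 1})

/-- A weakly convergent sequence of probability measures on a locally compact second countable
metrizable space is tight. -/
theorem isTightMeasureSet_range_of_tendsto {X : Type*} [TopologicalSpace X]
    [LocallyCompactSpace X] [SecondCountableTopology X] [TopologicalSpace.MetrizableSpace X]
    [MeasurableSpace X] [BorelSpace X] {μ : ℕ → ProbabilityMeasure X} {μ₀ : ProbabilityMeasure X}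
    (h : Tendsto μ atTop (nhds μ₀)) :
    IsTightMeasureSet (Set.range fun i => (μ i : Measure X)) := by
  let : MetricSpace X := TopologicalSpace.metrizableSpaceMetric X
  have tight (ρ : ProbabilityMeasure X) (ε : ENNReal) (hε : 0 < ε) :
      ∃ K : Set X, IsCompact K ∧ (ρ : Measure X) Kᶜ ≤ ε := by
    obtain ⟨K, hK, hle⟩ := isTightMeasureSet_iff_exists_isCompact_measure_compl_le.1
      (isTightMeasureSet_singleton_of_innerRegular (μ := (ρ : Measure X))) ε hε
    exact ⟨K, hK, hle _ rfl⟩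
  rw [isTightMeasureSet_iff_exists_isCompact_measure_compl_le]
  intro ε hε
  obtain ⟨δ, hδ, hδε⟩ := exists_between hε
  obtain ⟨K, hK, hKδ⟩ := tight μ₀ δ hδ
  obtain ⟨L, hL, hKL⟩ := exists_compact_superset hK
  have hlim : limsup (fun i => (μ i : Measure X) (interior L)ᶜ) atTop < ε :=
    calc limsup (fun i => (μ i : Measure X) (interior L)ᶜ) atTop
        ≤ (μ₀ : Measure X) (interior L)ᶜ :=
          ProbabilityMeasure.limsup_measure_closed_le_of_tendsto h isOpen_interior.isClosed_compl
      _ ≤ (μ₀ : Measure X) Kᶜ := measure_mono (Set.compl_subset_compl.2 hKL)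
      _ < ε := hKδ.trans_lt hδε
  obtain ⟨N, hN⟩ := eventually_atTop.1 (eventually_lt_of_limsup_lt hlim)
  choose C hC hCε using fun i => tight (μ i) ε hε
  refine ⟨L ∪ ⋃ i ∈ Finset.range N, C i,
    hL.union ((Finset.range N).isCompact_biUnion fun i _ => hC i), ?_⟩
  rintro _ ⟨i, rfl⟩
  rcases lt_or_ge i N with hi | hi
  · refine (measure_mono (Set.compl_subset_compl.2 ?_)).trans (hCε i)
    exact (Set.subset_biUnion_of_mem (u := C) (Finset.mem_coe.2 (Finset.mem_range.2 hi))).trans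
      Set.subset_union_right
  · refine (measure_mono (Set.compl_subset_compl.2 ?_)).trans (hN i hi).le
    exact interior_subset.trans Set.subset_union_left

/-- Tightness lifts along proper maps. -/
theorem MeasureTheory.IsTightMeasureSet.range_of_map_eq {ι X Y : Type*} [TopologicalSpace X]
    [MeasurableSpace X] [BorelSpace X] [TopologicalSpace Y] [T2Space Y] [MeasurableSpace Y]
    [BorelSpace Y] {μ : ι → Measure Y} (h : IsTightMeasureSet (Set.range μ)) {π : X → Y}
    (hπ : Continuous π) (hproper : ∀ K, IsCompact K → IsCompact (π ⁻¹' K))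
    {ν : ι → Measure X} (hν : ∀ i, (ν i).map π = μ i) :
    IsTightMeasureSet (Set.range ν) := by
  rw [isTightMeasureSet_iff_exists_isCompact_measure_compl_le] at h ⊢
  intro ε hε
  obtain ⟨K, hK, hle⟩ := h ε hε
  refine ⟨π ⁻¹' K, hproper K hK, ?_⟩
  rintro _ ⟨i, rfl⟩
  rw [← Set.preimage_compl, ← Measure.map_apply hπ.measurable hK.measurableSet.compl, hν]
  exact hle _ ⟨i, rfl⟩

/-- impossible section method: given `SL(2,ℝ)`-invariant probability measures
`μ i → λ` weak-*, a continuous proper equivariant `π : P → M`, and `μ i`-a.e. equivariant Borel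
sections `φ i` of `π`, there exists an `SL(2,ℝ)`-invariant probability measure on `P`
projecting to `λ`. -/
theorem impossible_section_method
    {M P : Type*}
    [TopologicalSpace M] [LocallyCompactSpace M] [SecondCountableTopology M]
    [TopologicalSpace.MetrizableSpace M] [MeasurableSpace M] [BorelSpace M]
    [TopologicalSpace P] [LocallyCompactSpace P] [SecondCountableTopology P]
    [TopologicalSpace.MetrizableSpace P] [MeasurableSpace P] [BorelSpace P]
    [MulAction SL2R M] [ContinuousSMul SL2R M]
    [MulAction SL2R P] [ContinuousSMul SL2R P]
    (lam : Measure M) [IsProbabilityMeasure lam]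
    (hlam_inv : ∀ g : SL2R, Measure.map (fun x => g • x) lam = lam)
    (μ : ℕ → Measure M) (hμprob : ∀ i, IsProbabilityMeasure (μ i))
    (hμinv : ∀ i, ∀ g : SL2R, Measure.map (fun x => g • x) (μ i) = μ i)
    (hconv : ∀ f : BoundedContinuousFunction M ℝ,
      Tendsto (fun i => ∫ x, f x ∂(μ i)) atTop (nhds (∫ x, f x ∂lam)))
    (π : P → M) (hπcont : Continuous π)
    (hπproper : ∀ K : Set M, IsCompact K → IsCompact (π ⁻¹' K))
    (hπequiv : ∀ (g : SL2R) (y : P), π (g • y) = g • π y)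
    (φ : ℕ → M → P) (hφmeas : ∀ i, Measurable (φ i))
    (hφsec : ∀ i, ∀ᵐ x ∂(μ i), π (φ i x) = x)
    (hφequiv : ∀ i, ∀ g : SL2R, ∀ᵐ x ∂(μ i), φ i (g • x) = g • φ i x) :
    ∃ ν : Measure P, IsProbabilityMeasure ν ∧
      (∀ g : SL2R, Measure.map (fun y => g • y) ν = ν) ∧
      Measure.map π ν = lam := by
  have hgM (g : SL2R) : Measurable fun x : M => g • x := (continuous_const_smul g).measurable
  have hgP (g : SL2R) : Measurable fun y : P => g • y := (continuous_const_smul g).measurable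
  let μ' : ℕ → ProbabilityMeasure M := fun i => ⟨μ i, hμprob i⟩
  let lam' : ProbabilityMeasure M := ⟨lam, inferInstance⟩
  have hμ' : Tendsto μ' atTop (nhds lam') :=
    ProbabilityMeasure.tendsto_iff_forall_integral_tendsto.2 hconv
  let ν : ℕ → ProbabilityMeasure P := fun i => (μ' i).map (hφmeas i).aemeasurable
  have hν (i : ℕ) : (ν i : Measure P) = (μ i).map (φ i) := rfl
  have hνπ (i : ℕ) : (ν i : Measure P).map π = μ i := by
    rw [hν, Measure.map_map hπcont.measurable (hφmeas i),
      Measure.map_congr (f := π ∘ φ i) (g := id) (hφsec i), Measure.map_id]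
  have hνinv (g : SL2R) (i : ℕ) : (ν i : Measure P).map (fun y => g • y) = ν i := by
    calc (ν i : Measure P).map (fun y => g • y)
        = (μ i).map (fun x => φ i (g • x)) := by
          rw [hν, Measure.map_map (hgP g) (hφmeas i)]
          exact Measure.map_congr ((hφequiv i g).mono fun x hx => hx.symm)
      _ = ((μ i).map (fun x => g • x)).map (φ i) :=
          (Measure.map_map (hφmeas i) (hgM g)).symm
      _ = ν i := by rw [hμinv i g, hν]
  have hrange : IsTightMeasureSet (Set.range fun i => (ν i : Measure P)) :=
    (isTightMeasureSet_range_of_tendsto hμ').range_of_map_eq hπcont hπproper hνπ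
  have hcompact : IsCompact (closure (Set.range ν)) :=
    isCompact_closure_of_isTightMeasureSet <| hrange.subset <| by
      rintro _ ⟨_, ⟨i, rfl⟩, rfl⟩
      exact ⟨i, rfl⟩
  obtain ⟨ν', -, k, hk, hlim⟩ :=
    hcompact.tendsto_subseq fun i => subset_closure (Set.mem_range_self i)
  refine ⟨ν', inferInstance, fun g => ?_, ?_⟩
  · have h := ProbabilityMeasure.tendsto_map_of_tendsto_of_continuous _ _ hlim
      (continuous_const_smul g)
    have h' : (fun i => ((ν ∘ k) i).map (hgP g).aemeasurable) = ν ∘ k :=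
      funext fun i => Subtype.ext (hνinv g (k i))
    exact congrArg ProbabilityMeasure.toMeasure (tendsto_nhds_unique (h' ▸ h) hlim)
  · have h := ProbabilityMeasure.tendsto_map_of_tendsto_of_continuous _ _ hlim hπcont
    have h' : (fun i => ((ν ∘ k) i).map hπcont.measurable.aemeasurable) = μ' ∘ k :=
      funext fun i => Subtype.ext (hνπ (k i))
    exact congrArg ProbabilityMeasure.toMeasure (tendsto_nhds_unique (h' ▸ h) (hμ'.comp hk.tendsto_atTop))
end

section
/- Let X be a locally compact second countable space equipped with a continuous action of SL(2,ℝ), let f : X → [1,∞] be Borel measurable, and let b > 0. Assume: (Lipschitz) for every compact subset K ⊆ SL(2,ℝ) there is σ_K ≥ 1 such that σ_K^{-1} f(x) ≤ f(g.x) ≤ σ_K f(x) for all g ∈ K and all x ∈ X; (Margulis inequality) for every c ∈ (0,1) there is t_c > 0 such that for all t ≥ t_c and all x ∈ X, (1/2π)∫_0^{2π} f(a(t) r_θ . x) dθ ≤ c f(x) + b. Then there exists b' > 0 such that for every c ∈ (0,1) there is ℓ_c > 0 such that for every integer ℓ ≥ ℓ_c and every x ∈ X, 2^{-ℓ} Σ_{i=0}^{2^ℓ−1}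 f(u(i) a(ℓ log 2) . x) ≤ c f(x) + b'. -/
open MeasureTheory

/-- The diagonal geodesic-flow matrices `a(t) = diag(e^{t/2}, e^{-t/2})`. -/
noncomputable def aMat (t : ℝ) : SL2R :=
  ⟨!![Real.exp (t / 2), 0; 0, Real.exp (-(t / 2))], by
    simp [Matrix.det_fin_two_of, ← Real.exp_add]⟩

/-- The upper-triangular unipotent matrices `u(s)`. -/
def uMat (s : ℝ) : SL2R :=
  ⟨!![1, s; 0, 1], by simp [Matrix.det_fin_two_of]⟩

/-- The rotation matrices `r_θ`. -/
noncomputable def rMat (θ : ℝ) : SL2R :=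
  ⟨!![Real.cos θ, -Real.sin θ; Real.sin θ, Real.cos θ], by
    rw [Matrix.det_fin_two_of]; ring_nf; rw [add_comm]; exact Real.sin_sq_add_cos_sq θ⟩

/-- Elements of `SL(2,ℝ)` with entries bounded by `M` form a compact set. -/
theorem isCompact_setOf_abs_entries_le (M : ℝ) :
    IsCompact {g : SL2R | ∀ i j, |g i j| ≤ M} := by
  have hclosed : IsClosed {A : Matrix (Fin 2) (Fin 2) ℝ | A.det = 1} :=
    isClosed_eq (continuous_id.matrix_det) continuous_const
  have hemb : Topology.IsClosedEmbedding (Subtype.val : SL2R → Matrix (Fin 2) (Fin 2) ℝ) :=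
    hclosed.isClosedEmbedding_subtypeVal
  have hK : IsCompact (Set.univ.pi fun _ : Fin 2 => Set.univ.pi fun _ : Fin 2 =>
      Set.Icc (-M) M : Set (Fin 2 → Fin 2 → ℝ)) :=
    isCompact_univ_pi fun _ => isCompact_univ_pi fun _ => isCompact_Icc
  refine (congrArg IsCompact (Set.ext fun g => ?_)).mp (hemb.isCompact_preimage hK)
  exact ⟨fun h i j => abs_le.2 (h i trivial j trivial), fun h i _ j _ => abs_le.1 (h i j)⟩

/-- The element carrying `a(t) r_θ x` to `u(i) a(t) x`, with `θ = 2π - arctan s` and `s` within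
`e^{-t}` of `i e^{-t}`, has bounded entries. -/
theorem abs_entries_uMat_mul_aMat_mul_inv_le {t i s : ℝ} (ht : 0 ≤ t)
    (hi : 0 ≤ i) (hit : i ≤ Real.exp t) (his : |i - Real.exp t * s| ≤ 1) (j k : Fin 2) :
    |(uMat i * aMat t * (aMat t * rMat (2 * Real.pi - Real.arctan s))⁻¹ : SL2R) j k| ≤ 2 := by
  set C := Real.cos (Real.arctan s) with hC
  set S := Real.sin (Real.arctan s) with hS
  have hC0 : 0 < C := Real.cos_arctan_pos s
  have hC1 : C ≤ 1 := Real.cos_le_one _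
  have hSC : S = s * C := by
    rw [hS, hC, ← Real.tan_mul_cos hC0.ne', Real.tan_arctan]
  have hS1 : |S| ≤ 1 := Real.abs_sin_le_one _
  have hcos : Real.cos (2 * Real.pi - Real.arctan s) = C := Real.cos_two_pi_sub _
  have hsin : Real.sin (2 * Real.pi - Real.arctan s) = -S := Real.sin_two_pi_sub _
  set h := Real.exp (t / 2) with hh
  have hpos : 0 < h := Real.exp_pos _
  have hexp : Real.exp t = h * h := by rw [hh, ← Real.exp_add]; ring_nf
  have hneg : Real.exp (-(t / 2)) = h⁻¹ := Real.exp_neg _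
  have hN : 1 ≤ h * h := by rw [← hexp]; exact Real.one_le_exp ht
  rw [hexp] at hit his
  have hq0 : 0 ≤ i / (h * h) := by positivity
  have hq1 : i / (h * h) ≤ 1 := div_le_one_of_le₀ hit (by positivity)
  have hinv : (h * h)⁻¹ ≤ 1 := inv_le_one_of_one_le₀ hN
  have hinv0 : 0 ≤ (h * h)⁻¹ := by positivity
  have key : ((uMat i * aMat t * (aMat t * rMat (2 * Real.pi - Real.arctan s))⁻¹ : SL2R) :
      Matrix (Fin 2) (Fin 2) ℝ) =
      !![C + i / (h * h) * S, C * (i - h * h * s); (h * h)⁻¹ * S, C] := by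
    simp only [Matrix.SpecialLinearGroup.coe_mul, Matrix.SpecialLinearGroup.coe_inv]
    simp only [uMat, aMat, rMat, hcos, hsin, hneg, ← hh]
    ext j k
    fin_cases j <;> fin_cases k <;>
      simp [Matrix.adjugate_fin_two, Matrix.mul_apply, Fin.sum_univ_two] <;>
      field_simp <;> grind
  rw [key]
  fin_cases j <;> fin_cases k <;> simp only [Fin.zero_eta, Fin.mk_one, Matrix.of_apply,
    Matrix.cons_val_zero, Matrix.cons_val_one, Matrix.cons_val', Matrix.cons_val_fin_one]
  · calc |C + i / (h * h) * S| ≤ |C| + |i / (h * h) * S| := abs_add_le _ _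
      _ ≤ 1 + 1 * 1 := by
        rw [abs_mul, abs_of_pos hC0, abs_of_nonneg hq0]
        gcongr
      _ = 2 := by norm_num
  · rw [abs_mul, abs_of_pos hC0]
    nlinarith [abs_nonneg (i - h * h * s)]
  · rw [abs_mul, abs_of_nonneg hinv0]
    nlinarith [abs_nonneg S]
  · rw [abs_of_pos hC0]; linarith

theorem sum_setLIntegral_Ioc_div (g : ℝ → ENNReal) {N : ℝ} (hN : 0 < N) (n : ℕ) :
    ∑ i ∈ Finset.range n, ∫⁻ s in Set.Ioc ((i : ℝ) / N) ((i + 1) / N), g s =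
      ∫⁻ s in Set.Ioc 0 (n / N), g s := by
  induction n with
  | zero => simp
  | succ n ih =>
    have hle : (n : ℝ) / N ≤ ((n + 1 : ℕ) : ℝ) / N := by
      gcongr
      simp
    rw [Finset.sum_range_succ, ih, ← Set.Ioc_union_Ioc_eq_Ioc (b := (n : ℝ) / N) (by positivity) hle,
      lintegral_union measurableSet_Ioc (Set.Ioc_disjoint_Ioc_of_le le_rfl)]
    simp

/-- The substitution `θ = 2π - arctan s` on `(0, 1]` has Jacobian at least `1/2`. -/
theorem setLIntegral_comp_two_pi_sub_arctan_le (g : ℝ → ENNReal) :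
    ∫⁻ s in Set.Ioc (0 : ℝ) 1, g (2 * Real.pi - Real.arctan s) ≤
      2 * ∫⁻ θ in Set.Ioc 0 (2 * Real.pi), g θ := by
  have hderiv : ∀ s ∈ Set.Ioc (0 : ℝ) 1, HasDerivWithinAt
      (fun s => 2 * Real.pi - Real.arctan s) (-(1 / (1 + s ^ 2))) (Set.Ioc 0 1) s :=
    fun s _ => ((Real.hasDerivAt_arctan s).const_sub _).hasDerivWithinAt
  have hinj : Set.InjOn (fun s => 2 * Real.pi - Real.arctan s) (Set.Ioc 0 1) :=
    fun x _ y _ hxy => Real.arctan_injective (sub_right_injective hxy)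
  have himage : (fun s => 2 * Real.pi - Real.arctan s) '' Set.Ioc 0 1 ⊆
      Set.Ioc 0 (2 * Real.pi) := by
    rintro _ ⟨s, hs, rfl⟩
    have h1 := Real.arctan_lt_pi_div_two s
    have h2 : 0 < Real.arctan s := Real.arctan_pos.2 hs.1
    constructor <;> dsimp only <;> linarith [Real.pi_pos]
  calc ∫⁻ s in Set.Ioc (0 : ℝ) 1, g (2 * Real.pi - Real.arctan s)
      ≤ ∫⁻ s in Set.Ioc (0 : ℝ) 1, 2 * (ENNReal.ofReal |-(1 / (1 + s ^ 2))| *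
          g (2 * Real.pi - Real.arctan s)) := by
        refine setLIntegral_mono' measurableSet_Ioc fun s hs => ?_
        have : (1 : ENNReal) ≤ 2 * ENNReal.ofReal |-(1 / (1 + s ^ 2))| := by
          rw [← ENNReal.ofReal_ofNat 2, ← ENNReal.ofReal_mul (by norm_num), ENNReal.one_le_ofReal,
            abs_neg, abs_of_pos (by positivity), mul_one_div, le_div_iff₀ (by positivity)]
          nlinarith [hs.1, hs.2]
        rw [← mul_assoc]
        exact le_mul_of_one_le_left' this
    _ = 2 * ∫⁻ θ in (fun s => 2 * Real.pi - Real.arctan s) '' Set.Ioc 0 1, g θ := by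
        rw [lintegral_const_mul' _ _ (by simp),
          lintegral_image_eq_lintegral_abs_deriv_mul measurableSet_Ioc hderiv hinj]
    _ ≤ 2 * ∫⁻ θ in Set.Ioc 0 (2 * Real.pi), g θ := by
        gcongr

/-- Averages over `u(i) a(ℓ log 2)` are dominated by integrals over `a(ℓ log 2) r_θ`. -/
theorem inv_two_pow_mul_sum_le {X : Type*} [MulAction SL2R X] (f : X → ENNReal) {σ : ENNReal}
    (hσ : σ ≠ ⊤) (hf : ∀ g : SL2R, (∀ i j, |g i j| ≤ 2) → ∀ x, f (g • x) ≤ σ * f x)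
    (l : ℕ) (x : X) :
    ((2 : ENNReal) ^ l)⁻¹ *
        ∑ i ∈ Finset.range (2 ^ l), f ((uMat i * aMat (l * Real.log 2)) • x) ≤
      σ * (2 * ∫⁻ θ in Set.Ioc 0 (2 * Real.pi), f ((aMat (l * Real.log 2) * rMat θ) • x)) := by
  set t := l * Real.log 2 with ht
  have ht0 : 0 ≤ t := mul_nonneg l.cast_nonneg (Real.log_nonneg one_le_two)
  have hexp : Real.exp t = 2 ^ l := by
    rw [ht, mul_comm, Real.exp_mul, Real.exp_log two_pos, Real.rpow_natCast]
  have hN : (0 : ℝ) < 2 ^ l := by positivity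
  set F : ℝ → ENNReal := fun θ => f ((aMat t * rMat θ) • x) with hF
  have hterm : ∀ i ∈ Finset.range (2 ^ l), ((2 : ENNReal) ^ l)⁻¹ * f ((uMat i * aMat t) • x) ≤
      ∫⁻ s in Set.Ioc ((i : ℝ) / 2 ^ l) ((i + 1) / 2 ^ l),
        σ * F (2 * Real.pi - Real.arctan s) := by
    intro i hi
    have hi' : (i : ℝ) ≤ 2 ^ l := by exact_mod_cast (Finset.mem_range.1 hi).le
    have hvol : volume (Set.Ioc ((i : ℝ) / 2 ^ l) ((i + 1) / 2 ^ l)) = ((2 : ENNReal) ^ l)⁻¹ := by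
      rw [Real.volume_Ioc, ← sub_div, add_sub_cancel_left, one_div,
        ENNReal.ofReal_inv_of_pos hN, ENNReal.ofReal_pow two_pos.le, ENNReal.ofReal_ofNat]
    rw [mul_comm, ← hvol, ← setLIntegral_const]
    refine setLIntegral_mono' measurableSet_Ioc fun s hs => ?_
    have h1 := (div_lt_iff₀ hN).1 hs.1
    have h2 := (le_div_iff₀ hN).1 hs.2
    have hbound := abs_entries_uMat_mul_aMat_mul_inv_le (s := s) ht0 i.cast_nonneg
      (hexp ▸ hi') (by rw [hexp, abs_le]; constructor <;> linarith)
    have := hf _ hbound ((aMat t * rMat (2 * Real.pi - Real.arctan s)) • x)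
    rwa [smul_smul, inv_mul_cancel_right] at this
  have hsum := sum_setLIntegral_Ioc_div (fun s => σ * F (2 * Real.pi - Real.arctan s)) hN (2 ^ l)
  rw [Nat.cast_pow, Nat.cast_ofNat, div_self hN.ne'] at hsum
  rw [Finset.mul_sum]
  refine (Finset.sum_le_sum hterm).trans ?_
  rw [hsum, lintegral_const_mul' _ _ hσ]
  gcongr
  exact setLIntegral_comp_two_pi_sub_arctan_le F

/-- a function `f : X → [1,∞]` satisfying the compact-Lipschitz property and the
Margulis inequality for the rotation averages also satisfies a Margulis inequality for averages
over the Markov chain `x ↦ u(i) a(ℓ log 2) x`, `0 ≤ i < 2^ℓ`. -/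
theorem margulis_inequality_for_discrete_averages
    {X : Type*} [TopologicalSpace X] [LocallyCompactSpace X] [SecondCountableTopology X]
    [MeasurableSpace X] [BorelSpace X]
    [MulAction SL2R X] [ContinuousSMul SL2R X]
    (f : X → ENNReal) (hfmeas : Measurable f) (hf1 : ∀ x, 1 ≤ f x)
    (b : ℝ) (hb : 0 < b)
    (hLip : ∀ K : Set SL2R, IsCompact K → ∃ σ : ℝ, 1 ≤ σ ∧ ∀ g ∈ K, ∀ x : X,
      (ENNReal.ofReal σ)⁻¹ * f x ≤ f (g • x) ∧ f (g • x) ≤ ENNReal.ofReal σ * f x)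
    (hMargulis : ∀ c : ℝ, c ∈ Set.Ioo (0 : ℝ) 1 → ∃ tc : ℝ, 0 < tc ∧
      ∀ t : ℝ, tc ≤ t → ∀ x : X,
        (ENNReal.ofReal (2 * Real.pi))⁻¹ *
            ∫⁻ θ in Set.Ioc 0 (2 * Real.pi), f ((aMat t * rMat θ) • x) ≤
          ENNReal.ofReal c * f x + ENNReal.ofReal b) :
    ∃ b' : ℝ, 0 < b' ∧ ∀ c : ℝ, c ∈ Set.Ioo (0 : ℝ) 1 → ∃ lc : ℕ, 0 < lc ∧
      ∀ l : ℕ, lc ≤ l → ∀ x : X,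
        ((2 : ENNReal) ^ l)⁻¹ *
            ∑ i ∈ Finset.range (2 ^ l), f ((uMat i * aMat (l * Real.log 2)) • x) ≤
          ENNReal.ofReal c * f x + ENNReal.ofReal b' := by
  obtain ⟨σ, hσ1, hσ⟩ := hLip _ (isCompact_setOf_abs_entries_le 2)
  have hπ := Real.pi_pos
  have hσ0 : 0 < σ := by linarith
  set D : ℝ := σ * (2 * (2 * Real.pi)) with hD
  have hD0 : 0 < D := by positivity
  have hD1 : 1 ≤ D := by nlinarith [Real.pi_gt_three]
  refine ⟨D * b, by positivity, fun c hc => ?_⟩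
  obtain ⟨tc, -, htc⟩ := hMargulis (c / D)
    ⟨div_pos hc.1 hD0, (div_le_self hc.1.le hD1).trans_lt hc.2⟩
  have hlog : 0 < Real.log 2 := Real.log_pos one_lt_two
  obtain ⟨n, hn⟩ := exists_nat_ge (tc / Real.log 2)
  refine ⟨n + 1, n.succ_pos, fun l hl x => ?_⟩
  have hnl : (n : ℝ) ≤ l := by exact_mod_cast (n.le_succ.trans hl)
  have hmain := htc (l * Real.log 2) ((div_le_iff₀ hlog).1 (hn.trans hnl)) x
  have h2π : ENNReal.ofReal (2 * Real.pi) ≠ 0 := by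
    simpa using hπ
  rw [ENNReal.inv_mul_le_iff h2π ENNReal.ofReal_ne_top] at hmain
  refine (inv_two_pow_mul_sum_le f (σ := ENNReal.ofReal σ) ENNReal.ofReal_ne_top
    (fun g hg x => (hσ g hg x).2) l x).trans ?_
  calc _ ≤ ENNReal.ofReal σ * (2 * (ENNReal.ofReal (2 * Real.pi) *
          (ENNReal.ofReal (c / D) * f x + ENNReal.ofReal b))) := by gcongr
    _ = ENNReal.ofReal D * (ENNReal.ofReal (c / D) * f x + ENNReal.ofReal b) := by
        rw [hD, ENNReal.ofReal_mul hσ0.le, ENNReal.ofReal_mul (q := 2 * Real.pi) two_pos.le, ENNReal.ofReal_ofNat]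
        ring
    _ = ENNReal.ofReal c * f x + ENNReal.ofReal (D * b) := by
        rw [mul_add, ← mul_assoc, ← ENNReal.ofReal_mul hD0.le, ← ENNReal.ofReal_mul hD0.le,
          mul_div_cancel₀ _ hD0.ne']
end

section
/- For s ∈ ℝ set L(s) = u(s) · r_{arctan s} ∈ SL(2,ℝ). Then: (i) for every s ∈ [0,1] the matrix L(s) is lower triangular; (ii) the set { a(t) L(s) a(−t) : s ∈ [0,1], t ≥ 0 } has compact closure in SL(2,ℝ). -/
/-- `L(s) = u(s) r_{arctan s}`. -/
noncomputable def LMat (s : ℝ) : SL2R := uMat s * rMat (Real.arctan s)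

/-- The lower triangular matrix `[[√(1+s²), 0], [c s/√(1+s²), 1/√(1+s²)]]`. -/
noncomputable def lowerTriangularSL (p : ℝ × ℝ) : SL2R :=
  ⟨!![√(1 + p.1 ^ 2), 0; p.2 * (p.1 / √(1 + p.1 ^ 2)), 1 / √(1 + p.1 ^ 2)], by
    have h : √(1 + p.1 ^ 2) ≠ 0 := by positivity
    simp [Matrix.det_fin_two_of, h]⟩

theorem continuous_lowerTriangularSL : Continuous lowerTriangularSL := by
  refine Continuous.subtype_mk (continuous_matrix fun i j ↦ ?_) _
  have h (p : ℝ × ℝ) : √(1 + p.1 ^ 2) ≠ 0 := by positivity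
  fin_cases i <;> fin_cases j <;> simp <;> fun_prop (disch := simpa using h)

theorem LMat_eq_lowerTriangularSL (s : ℝ) : LMat s = lowerTriangularSL (s, 1) := by
  have h : √(1 + s ^ 2) ≠ 0 := by positivity
  have h2 : √(1 + s ^ 2) ^ 2 = 1 + s ^ 2 := Real.sq_sqrt (by positivity)
  ext i j
  rw [LMat, Matrix.SpecialLinearGroup.coe_mul]
  fin_cases i <;> fin_cases j <;>
    simp [uMat, rMat, lowerTriangularSL, Real.cos_arctan, Real.sin_arctan] <;>
    field_simp <;> linarith

theorem aMat_mul_lowerTriangularSL_mul_aMat_neg (s c t : ℝ) :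
    aMat t * lowerTriangularSL (s, c) * aMat (-t) =
      lowerTriangularSL (s, Real.exp (-t) * c) := by
  have h : √(1 + s ^ 2) ≠ 0 := by positivity
  have h1 : Real.exp (t / 2) * Real.exp (-t / 2) = 1 := by
    rw [← Real.exp_add]; ring_nf; exact Real.exp_zero
  have h2 : Real.exp (-t) = Real.exp (-t / 2) ^ 2 := by
    rw [sq, ← Real.exp_add]; ring_nf
  ext i j
  rw [Matrix.SpecialLinearGroup.coe_mul, Matrix.SpecialLinearGroup.coe_mul]
  fin_cases i <;> fin_cases j <;> simp [aMat, lowerTriangularSL, ← neg_div, h2] <;>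
    grind

instance : T2Space SL2R :=
  inferInstanceAs (T2Space {A : Matrix (Fin 2) (Fin 2) ℝ // A.det = 1})

/-- (i) for `s ∈ [0,1]` the matrix `L(s) = u(s) r_{arctan s}` is lower triangular;
(ii) the set `{a(t) L(s) a(-t) : s ∈ [0,1], t ≥ 0}` has compact closure in `SL(2,ℝ)`. -/
theorem LMat_lower_triangular_and_conjugates_bounded :
    (∀ s ∈ Set.Icc (0 : ℝ) 1, ((LMat s : SL2R) : Matrix (Fin 2) (Fin 2) ℝ) 0 1 = 0) ∧
      IsCompact (closure
        {g : SL2R | ∃ s ∈ Set.Icc (0 : ℝ) 1, ∃ t : ℝ, 0 ≤ t ∧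
          g = aMat t * LMat s * aMat (-t)}) := by
  refine ⟨fun s _ ↦ by simp [LMat_eq_lowerTriangularSL, lowerTriangularSL], ?_⟩
  refine ((isCompact_Icc.prod isCompact_Icc).image
    continuous_lowerTriangularSL : IsCompact
      (lowerTriangularSL '' (Set.Icc 0 1 ×ˢ Set.Icc 0 1))).closure_of_subset ?_
  rintro _ ⟨s, hs, t, ht, rfl⟩
  rw [LMat_eq_lowerTriangularSL, aMat_mul_lowerTriangularSL_mul_aMat_neg, mul_one]
  exact ⟨(s, Real.exp (-t)), ⟨hs, (Real.exp_pos _).le, Real.exp_le_one_iff.2 (by linarith)⟩, rfl⟩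
end

section
/- Let ℓ be a positive integer, δ ≥ 0, b' > 0, and T₁ ≥ max(b', log 2). Let f₀ ≥ 1 and f_0, …, f_{2^ℓ−1} ≥ 1 be real numbers (indices i = 0, …, 2^ℓ − 1), and set α₀ = log f₀ and α_i = log f_i. Assume: |α_i − α₀| ≤ T₁ for all i; 2^{-ℓ} Σ_{i=0}^{2^ℓ−1} f_i ≤ (1/8) f₀ + b'; f₀ ≥ 8T₁; and p_0, …, p_{2^ℓ−1} ≥ 0 satisfy Σ_i p_i = 1 and |p_i − 2^{-ℓ}| ≤ δ for all i. Then Σ_{i=0}^{2^ℓ−1} p_i α_i ≤ α₀ − 2 log 2 + 2^ℓ δ T₁. -/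
/-- An elementary real-number estimate: if `|α i - α₀| ≤ T₁`, the averages of the
`f i = exp (α i)` decay (`2^{-ℓ} Σ f i ≤ f₀/8 + b'`), `f₀ ≥ 8 T₁`, and the weights `p i` are
`δ`-close to uniform, then `Σ p i • α i ≤ α₀ - 2 log 2 + 2^ℓ δ T₁`. -/
theorem weighted_log_average_decay
    (l : ℕ) (hl : 0 < l) (δ b' T₁ : ℝ) (hδ : 0 ≤ δ) (hb' : 0 < b')
    (hT₁ : max b' (Real.log 2) ≤ T₁)
    (f₀ : ℝ) (hf₀ : 1 ≤ f₀)
    (f : ℕ → ℝ) (hf : ∀ i ∈ Finset.range (2 ^ l), 1 ≤ f i)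
    (α₀ : ℝ) (hα₀ : α₀ = Real.log f₀)
    (α : ℕ → ℝ) (hα : ∀ i ∈ Finset.range (2 ^ l), α i = Real.log (f i))
    (hclose : ∀ i ∈ Finset.range (2 ^ l), |α i - α₀| ≤ T₁)
    (hdecay : ((2 : ℝ) ^ l)⁻¹ * ∑ i ∈ Finset.range (2 ^ l), f i ≤ (1 / 8) * f₀ + b')
    (hbig : 8 * T₁ ≤ f₀)
    (p : ℕ → ℝ) (hp0 : ∀ i ∈ Finset.range (2 ^ l), 0 ≤ p i)
    (hpsum : ∑ i ∈ Finset.range (2 ^ l), p i = 1)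
    (hpδ : ∀ i ∈ Finset.range (2 ^ l), |p i - ((2 : ℝ) ^ l)⁻¹| ≤ δ) :
    ∑ i ∈ Finset.range (2 ^ l), p i * α i ≤ α₀ - 2 * Real.log 2 + 2 ^ l * δ * T₁ := by
  have hf0 : 0 < f₀ := by linarith
  have hb : b' ≤ T₁ := (le_max_left _ _).trans hT₁
  have hN : (0 : ℝ) < 2 ^ l := by positivity
  have hlog4 : Real.log 4 = 2 * Real.log 2 := by
    rw [show (4 : ℝ) = 2 ^ 2 by norm_num, Real.log_pow]
    norm_num
  have hterm : ∀ i ∈ Finset.range (2 ^ l), p i * α i ≤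
      p i * α₀ + (((2 : ℝ) ^ l)⁻¹ * f i * (4 / f₀)
        + (((2 : ℝ) ^ l)⁻¹ * (-(2 * Real.log 2) - 1) + δ * T₁)) := by
    intro i hi
    have hfi : 0 < f i := by linarith [hf i hi]
    have hlog : α i - α₀ ≤ f i * (4 / f₀) - 2 * Real.log 2 - 1 := by
      have h := Real.log_le_sub_one_of_pos (show 0 < f i * (4 / f₀) by positivity)
      rw [Real.log_mul hfi.ne' (by positivity), Real.log_div (by norm_num) hf0.ne',
        hlog4, ← hα i hi, ← hα₀] at h
      linarith
    have hmain := mul_le_mul_of_nonneg_left hlog (inv_nonneg.mpr hN.le)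
    have herr : (p i - ((2 : ℝ) ^ l)⁻¹) * (α i - α₀) ≤ δ * T₁ :=
      (le_abs_self _).trans ((abs_mul _ _).trans_le
        (mul_le_mul (hpδ i hi) (hclose i hi) (abs_nonneg _) hδ))
    linarith
  refine (Finset.sum_le_sum hterm).trans ?_
  rw [Finset.sum_add_distrib, Finset.sum_add_distrib, ← Finset.sum_mul, ← Finset.sum_mul,
    ← Finset.mul_sum, hpsum, Finset.sum_const, Finset.card_range, nsmul_eq_mul, mul_add,
    Nat.cast_pow, Nat.cast_ofNat, mul_inv_cancel_left₀ hN.ne']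
  have hmean : ((2 : ℝ) ^ l)⁻¹ * (∑ i ∈ Finset.range (2 ^ l), f i) * (4 / f₀) ≤ 1 := by
    rw [mul_div_assoc', div_le_one hf0]
    linarith
  linarith
end

section
/- Let d ≥ 2. There is no Sp(2d,ℝ)-invariant Borel probability measure on the Grassmannian Gr(ℝ^{2d}, 2) of 2-dimensional linear subspaces of ℝ^{2d}, where Sp(2d,ℝ) acts by V ↦ S·V. -/
open MeasureTheory Matrix

/-- Pairs of linearly independent vectors in `ℝ^n`. -/
abbrev GrPair (n : ℕ) := {p : (Fin n → ℝ) × (Fin n → ℝ) // LinearIndependent ℝ ![p.1, p.2]}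

/-- Two pairs are identified iff they span the same plane. -/
def grSetoid (n : ℕ) : Setoid (GrPair n) where
  r p q := Submodule.span ℝ {p.1.1, p.1.2} = Submodule.span ℝ {q.1.1, q.1.2}
  iseqv := ⟨fun _ => rfl, Eq.symm, Eq.trans⟩

/-- The Grassmannian `Gr(ℝ^n, 2)` of `2`-dimensional subspaces of `ℝ^n`, realized as the quotient
of the set of linearly independent pairs by the relation of having equal span, with the quotient
topology. -/
def Gr2 (n : ℕ) : Type := Quotient (grSetoid n)

instance (n : ℕ) : TopologicalSpace (Gr2 n) := instTopologicalSpaceQuotient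

instance (n : ℕ) : MeasurableSpace (Gr2 n) := borel (Gr2 n)

/-- The plane represented by a point of the Grassmannian. -/
def Gr2.toSubmodule {n : ℕ} : Gr2 n → Submodule ℝ (Fin n → ℝ) :=
  Quotient.lift (fun p : GrPair n => Submodule.span ℝ {p.1.1, p.1.2}) (fun _ _ h => h)

/-- The action of an injective matrix on the Grassmannian `Gr(ℝ^n, 2)`, `V ↦ S·V`. -/
noncomputable def grMap {n : ℕ} (S : Matrix (Fin n) (Fin n) ℝ)
    (hS : Function.Injective S.mulVecLin) : Gr2 n → Gr2 n :=
  Quotient.map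
    (fun p => ⟨(S.mulVec p.1.1, S.mulVec p.1.2), by
      have h : ![S.mulVec p.1.1, S.mulVec p.1.2] = S.mulVecLin ∘ ![p.1.1, p.1.2] := by
        funext i
        fin_cases i <;> simp [Matrix.mulVecLin_apply]
      rw [h]
      exact p.2.map' S.mulVecLin (LinearMap.ker_eq_bot.mpr hS)⟩)
    (fun a b hab => by
      have key : ∀ v w : Fin n → ℝ,
          Submodule.span ℝ {S.mulVec v, S.mulVec w} =
            Submodule.map S.mulVecLin (Submodule.span ℝ ({v, w} : Set (Fin n → ℝ))) := by
        intro v w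
        rw [Submodule.map_span]
        congr 1
        simp [Set.image_insert_eq, Matrix.mulVecLin_apply]
      show Submodule.span ℝ {S.mulVec a.1.1, S.mulVec a.1.2} =
        Submodule.span ℝ {S.mulVec b.1.1, S.mulVec b.1.2}
      rw [key, key]
      exact congrArg _ hab)

/-- The standard symplectic form matrix `J = [[0, I_d], [-I_d, 0]]` on `ℝ^{2d}` (with
`2d = d + d`). -/
noncomputable def Jstd (d : ℕ) : Matrix (Fin (d + d)) (Fin (d + d)) ℝ :=
  Matrix.reindex finSumFinEquiv finSumFinEquiv
    (Matrix.fromBlocks (0 : Matrix (Fin d) (Fin d) ℝ) 1 (-1) 0)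

instance (n : ℕ) : BorelSpace (Gr2 n) := ⟨rfl⟩

section Pluecker

variable {n : ℕ}

/-- The coordinates `v i * w j - v j * w i` of the bivector `v ∧ w`. -/
def wedgeCoord (v w : Fin n → ℝ) (i j : Fin n) : ℝ := v i * w j - v j * w i

/-- The squared norm of the bivector `v ∧ w`. -/
def wedgeNormSq (v w : Fin n → ℝ) : ℝ := ∑ i, ∑ j, wedgeCoord v w i j ^ 2

lemma wedgeNormSq_nonneg (v w : Fin n → ℝ) : 0 ≤ wedgeNormSq v w :=
  Finset.sum_nonneg fun _ _ => Finset.sum_nonneg fun _ _ => sq_nonneg _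

lemma wedgeCoord_sq_le_wedgeNormSq (v w : Fin n → ℝ) (i j : Fin n) :
    wedgeCoord v w i j ^ 2 ≤ wedgeNormSq v w :=
  (Finset.single_le_sum (f := fun j => wedgeCoord v w i j ^ 2)
    (fun _ _ => sq_nonneg _) (Finset.mem_univ j)).trans
  (Finset.single_le_sum (f := fun i => ∑ j, wedgeCoord v w i j ^ 2)
    (fun _ _ => Finset.sum_nonneg fun _ _ => sq_nonneg _) (Finset.mem_univ i))

lemma wedgeCoord_eq_zero_of_wedgeNormSq_eq_zero {v w : Fin n → ℝ} (h : wedgeNormSq v w = 0)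
    (i j : Fin n) : wedgeCoord v w i j = 0 :=
  sq_eq_zero_iff.mp (le_antisymm (h ▸ wedgeCoord_sq_le_wedgeNormSq v w i j) (sq_nonneg _))

/-- If `v ∧ w = 0` and `v ≠ 0` then `w` is a multiple of `v`. -/
lemma exists_eq_smul_of_wedgeNormSq_eq_zero {v w : Fin n → ℝ} (h : wedgeNormSq v w = 0)
    (hv : v ≠ 0) : ∃ c : ℝ, w = c • v := by
  obtain ⟨i, hi⟩ := Function.ne_iff.mp hv
  have hi : v i ≠ 0 := hi
  refine ⟨w i / v i, funext fun j => ?_⟩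
  have := wedgeCoord_eq_zero_of_wedgeNormSq_eq_zero h i j
  simp only [wedgeCoord] at this
  simp only [Pi.smul_apply, smul_eq_mul]
  field_simp
  linarith

lemma wedgeNormSq_pos {v w : Fin n → ℝ} (h : LinearIndependent ℝ ![v, w]) :
    0 < wedgeNormSq v w := by
  refine (wedgeNormSq_nonneg v w).lt_of_ne' fun h0 => ?_
  obtain ⟨c, hc⟩ := exists_eq_smul_of_wedgeNormSq_eq_zero h0 (h.ne_zero 0)
  have := (LinearIndependent.pair_iff.mp h c (-1) (by simp [hc])).2
  norm_num at this

lemma wedgeNormSq_smul_right (a : ℝ) (v w : Fin n → ℝ) :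
    wedgeNormSq v (a • w) = a ^ 2 * wedgeNormSq v w := by
  simp only [wedgeNormSq, Finset.mul_sum, wedgeCoord, Pi.smul_apply, smul_eq_mul]
  refine Finset.sum_congr rfl fun i _ => Finset.sum_congr rfl fun j _ => ?_
  ring

lemma wedgeNormSq_linear_combination (a b c d : ℝ) (v w : Fin n → ℝ) :
    wedgeNormSq (a • v + b • w) (c • v + d • w) = (a * d - b * c) ^ 2 * wedgeNormSq v w := by
  simp only [wedgeNormSq, Finset.mul_sum, wedgeCoord, Pi.smul_apply, Pi.add_apply, smul_eq_mul]
  refine Finset.sum_congr rfl fun i _ => Finset.sum_congr rfl fun j _ => ?_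
  ring

lemma continuous_wedgeNormSq :
    Continuous fun p : (Fin n → ℝ) × (Fin n → ℝ) => wedgeNormSq p.1 p.2 := by
  unfold wedgeNormSq wedgeCoord
  fun_prop

end Pluecker

section Transvection

variable {n : ℕ}

/-- The contraction of the bivector `v ∧ w` with the linear form `x ↦ l ⬝ᵥ x`. -/
def contract (l v w : Fin n → ℝ) : Fin n → ℝ := (l ⬝ᵥ v) • w - (l ⬝ᵥ w) • v

lemma continuous_contract {l : Fin n → ℝ} :
    Continuous fun p : (Fin n → ℝ) × (Fin n → ℝ) => contract l p.1 p.2 := by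
  unfold contract dotProduct
  fun_prop

lemma contract_linear_combination (l v w : Fin n → ℝ) (a b c d : ℝ) :
    contract l (a • v + b • w) (c • v + d • w) = (a * d - b * c) • contract l v w := by
  ext i
  simp only [contract, dotProduct_add, dotProduct_smul, Pi.sub_apply, Pi.add_apply, Pi.smul_apply,
    smul_eq_mul]
  ring

/-- The ratio `|N p|² / (|N p|² + |p|²)`, where `p = v ∧ w` and `N p = u ∧ contract l v w` is the
action on bivectors of the rank one endomorphism `x ↦ (l ⬝ᵥ x) • u`. -/
noncomputable def pairRatio (u l v w : Fin n → ℝ) : ℝ :=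
  wedgeNormSq u (contract l v w) / (wedgeNormSq u (contract l v w) + wedgeNormSq v w)

lemma pairRatio_nonneg (u l v w : Fin n → ℝ) : 0 ≤ pairRatio u l v w :=
  div_nonneg (wedgeNormSq_nonneg _ _) (add_nonneg (wedgeNormSq_nonneg _ _) (wedgeNormSq_nonneg _ _))

lemma pairRatio_le_one (u l v w : Fin n → ℝ) : pairRatio u l v w ≤ 1 :=
  div_le_one_of_le₀ (le_add_of_nonneg_right (wedgeNormSq_nonneg _ _))
    (add_nonneg (wedgeNormSq_nonneg _ _) (wedgeNormSq_nonneg _ _))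

lemma pairRatio_eq_of_span_eq (u l : Fin n → ℝ) {p q : GrPair n}
    (h : Submodule.span ℝ {p.1.1, p.1.2} = Submodule.span ℝ {q.1.1, q.1.2}) :
    pairRatio u l p.1.1 p.1.2 = pairRatio u l q.1.1 q.1.2 := by
  have h1 : p.1.1 ∈ Submodule.span ℝ {q.1.1, q.1.2} := h ▸ Submodule.subset_span (by simp)
  have h2 : p.1.2 ∈ Submodule.span ℝ {q.1.1, q.1.2} := h ▸ Submodule.subset_span (by simp)
  obtain ⟨a, b, hab⟩ := Submodule.mem_span_pair.mp h1
  obtain ⟨c, d, hcd⟩ := Submodule.mem_span_pair.mp h2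
  have hpos := wedgeNormSq_pos p.2
  rw [← hab, ← hcd, wedgeNormSq_linear_combination] at hpos
  have hD : (a * d - b * c) ^ 2 ≠ 0 := fun h0 => by simp [h0] at hpos
  rw [← hab, ← hcd, pairRatio, contract_linear_combination, wedgeNormSq_linear_combination,
    wedgeNormSq_smul_right, ← mul_add, mul_div_mul_left _ _ hD, pairRatio]

/-- The function induced by `pairRatio` on the Grassmannian. -/
noncomputable def grRatio (u l : Fin n → ℝ) : Gr2 n → ℝ :=
  Quotient.lift (fun p : GrPair n => pairRatio u l p.1.1 p.1.2)
    fun _ _ h => pairRatio_eq_of_span_eq u l h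

lemma continuous_grRatio (u l : Fin n → ℝ) : Continuous (grRatio u l) := by
  have hpair : Continuous fun p : GrPair n => (u, contract l p.1.1 p.1.2) :=
    continuous_const.prodMk (continuous_contract.comp continuous_subtype_val)
  have hA : Continuous fun p : GrPair n => wedgeNormSq u (contract l p.1.1 p.1.2) :=
    (continuous_wedgeNormSq.comp hpair :)
  have hB : Continuous fun p : GrPair n => wedgeNormSq p.1.1 p.1.2 :=
    continuous_wedgeNormSq.comp continuous_subtype_val
  have hAB : Continuous fun p : GrPair n => pairRatio u l p.1.1 p.1.2 :=
    hA.div (hA.add hB) fun p =>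
      (add_pos_of_nonneg_of_pos (wedgeNormSq_nonneg _ _) (wedgeNormSq_pos p.2)).ne'
  exact hAB.quotient_lift _

/-- The matrix of `x ↦ x + t * (l ⬝ᵥ x) • u`. -/
noncomputable def transvectionMatrix (u l : Fin n → ℝ) (t : ℝ) : Matrix (Fin n) (Fin n) ℝ :=
  1 + t • vecMulVec u l

lemma transvectionMatrix_mulVec (u l : Fin n → ℝ) (t : ℝ) (x : Fin n → ℝ) :
    transvectionMatrix u l t *ᵥ x = x + (t * (l ⬝ᵥ x)) • u := by
  ext i
  simp [transvectionMatrix, add_mulVec, smul_mulVec, vecMulVec_mulVec]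
  ring

lemma dotProduct_transvectionMatrix_mulVec {u l : Fin n → ℝ} (hlu : l ⬝ᵥ u = 0) (t : ℝ)
    (x : Fin n → ℝ) : l ⬝ᵥ (transvectionMatrix u l t *ᵥ x) = l ⬝ᵥ x := by
  simp [transvectionMatrix_mulVec, hlu]

lemma transvectionMatrix_injective {u l : Fin n → ℝ} (hlu : l ⬝ᵥ u = 0) (t : ℝ) :
    Function.Injective (transvectionMatrix u l t).mulVecLin := by
  intro x y hxy
  simp only [mulVecLin_apply] at hxy
  have h := congrArg (l ⬝ᵥ ·) hxy
  simp only [dotProduct_transvectionMatrix_mulVec hlu] at h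
  simpa [transvectionMatrix_mulVec, h] using hxy

lemma transvectionMatrix_preserves {J : Matrix (Fin n) (Fin n) ℝ} (hJ : Jᵀ = -J)
    {u : Fin n → ℝ} (hu : (u ᵥ* J) ⬝ᵥ u = 0) (t : ℝ) :
    (transvectionMatrix u (u ᵥ* J) t)ᵀ * J * transvectionMatrix u (u ᵥ* J) t = J := by
  have hJu : J *ᵥ u = -(u ᵥ* J) := by
    rw [← vecMul_transpose, hJ, vecMul_neg]
  have hleft : (transvectionMatrix u (u ᵥ* J) t)ᵀ * J =
      J + t • vecMulVec (u ᵥ* J) (u ᵥ* J) := by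
    rw [transvectionMatrix, transpose_add, transpose_one, transpose_smul, transpose_vecMulVec,
      Matrix.add_mul, Matrix.one_mul, Matrix.smul_mul, vecMulVec_mul]
  rw [hleft, transvectionMatrix, Matrix.mul_add, Matrix.mul_one, Matrix.mul_smul, Matrix.add_mul,
    mul_vecMulVec, hJu, Matrix.smul_mul, vecMulVec_mul_vecMulVec, hu]
  simp [neg_vecMulVec]

lemma wedgeCoord_transvection (u l v w : Fin n → ℝ) (t : ℝ) (i j : Fin n) :
    wedgeCoord (transvectionMatrix u l t *ᵥ v) (transvectionMatrix u l t *ᵥ w) i j =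
      wedgeCoord v w i j + t * wedgeCoord u (contract l v w) i j := by
  simp only [transvectionMatrix_mulVec, wedgeCoord, contract, Pi.add_apply, Pi.sub_apply,
    Pi.smul_apply, smul_eq_mul]
  ring

lemma contract_transvection {u l : Fin n → ℝ} (hlu : l ⬝ᵥ u = 0) (t : ℝ)
    (v w : Fin n → ℝ) :
    contract l (transvectionMatrix u l t *ᵥ v) (transvectionMatrix u l t *ᵥ w) =
      contract l v w := by
  ext i
  simp only [contract, dotProduct_transvectionMatrix_mulVec hlu]
  simp only [transvectionMatrix_mulVec, Pi.add_apply, Pi.sub_apply, Pi.smul_apply, smul_eq_mul]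
  ring

open Filter Topology in
lemma tendsto_pairRatio_transvection {u l : Fin n → ℝ} (hlu : l ⬝ᵥ u = 0) (v w : Fin n → ℝ) :
    Tendsto (fun k : ℕ => pairRatio u l (transvectionMatrix u l k *ᵥ v)
      (transvectionMatrix u l k *ᵥ w)) atTop (𝓝 0) := by
  simp only [pairRatio, contract_transvection hlu]
  by_cases h0 : wedgeNormSq u (contract l v w) = 0
  · simp [h0]
  obtain ⟨i, j, hij⟩ : ∃ i j, wedgeCoord u (contract l v w) i j ≠ 0 := by
    by_contra! h
    exact h0 (by simp [wedgeNormSq, h])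
  refine Tendsto.div_atTop tendsto_const_nhds (tendsto_atTop_add_const_left _ _ ?_)
  refine tendsto_atTop_mono (fun k => wedgeCoord_sq_le_wedgeNormSq _ _ i j) ?_
  simp only [wedgeCoord_transvection]
  have habs : Tendsto (fun k : ℕ => |wedgeCoord v w i j +
      k * wedgeCoord u (contract l v w) i j|) atTop atTop := by
    rcases lt_or_gt_of_ne hij with h | h
    · exact tendsto_abs_atBot_atTop.comp (tendsto_atBot_add_const_left _ _
        (tendsto_natCast_atTop_atTop.atTop_mul_const_of_neg h))
    · exact tendsto_abs_atTop_atTop.comp (tendsto_atTop_add_const_left _ _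
        (tendsto_natCast_atTop_atTop.atTop_mul_const h))
  simpa only [Function.comp_def, sq_abs] using (tendsto_pow_atTop two_ne_zero).comp habs

end Transvection

section Invariance

variable {n : ℕ}

open Filter Topology in
/-- A probability measure invariant under a one-parameter group of transvections is concentrated on the
zero set of `grRatio`. -/
lemma ae_grRatio_eq_zero {u l : Fin n → ℝ} (hlu : l ⬝ᵥ u = 0) {ν : Measure (Gr2 n)}
    [IsProbabilityMeasure ν]
    (hν : ∀ t : ℝ, ν.map (grMap (transvectionMatrix u l t) (transvectionMatrix_injective hlu t))
      = ν) : ∀ᵐ V ∂ν, grRatio u l V = 0 := by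
  let g : ℕ → Gr2 n → Gr2 n := fun k =>
    grMap (transvectionMatrix u l k) (transvectionMatrix_injective hlu k)
  have hmap (k : ℕ) : ν.map (g k) = ν := hν k
  have hg (k : ℕ) : AEMeasurable (g k) ν := by
    refine AEMeasurable.of_map_ne_zero ?_
    rw [hmap k]
    exact IsProbabilityMeasure.ne_zero ν
  have hf := (continuous_grRatio u l).measurable
  have hbound (V : Gr2 n) : 0 ≤ grRatio u l V ∧ grRatio u l V ≤ 1 := by
    induction V using Quotient.inductionOn with
    | h p => exact ⟨pairRatio_nonneg .., pairRatio_le_one ..⟩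
  have hnorm (V : Gr2 n) : ‖grRatio u l V‖ ≤ 1 := by
    rw [Real.norm_of_nonneg (hbound V).1]
    exact (hbound V).2
  have hlim : Tendsto (fun k => ∫ V, grRatio u l (g k V) ∂ν) atTop (𝓝 (∫ _, (0 : ℝ) ∂ν)) := by
    refine tendsto_integral_of_dominated_convergence (fun _ => 1)
      (fun k => (hf.comp_aemeasurable (hg k)).aestronglyMeasurable) (integrable_const _)
      (fun k => ae_of_all _ fun V => hnorm _) (ae_of_all _ fun V => ?_)
    induction V using Quotient.inductionOn with
    | h p => exact tendsto_pairRatio_transvection hlu p.1.1 p.1.2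
  have hconst (k : ℕ) : ∫ V, grRatio u l (g k V) ∂ν = ∫ V, grRatio u l V ∂ν := by
    rw [← integral_map (hg k) hf.aestronglyMeasurable, hmap k]
  simp only [hconst, integral_zero] at hlim
  have hint : Integrable (grRatio u l) ν :=
    Integrable.of_bound hf.aestronglyMeasurable 1 (ae_of_all _ hnorm)
  exact (integral_eq_zero_iff_of_nonneg (fun V => (hbound V).1) hint).mp
    (tendsto_nhds_unique tendsto_const_nhds hlim)

/-- A plane in the zero set of `grRatio u l` contains `u` or lies in the kernel of `l`. -/
lemma mem_span_or_of_pairRatio_eq_zero {u l : Fin n → ℝ} (hu : u ≠ 0) (p : GrPair n)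
    (h : pairRatio u l p.1.1 p.1.2 = 0) :
    u ∈ Submodule.span ℝ {p.1.1, p.1.2} ∨ (l ⬝ᵥ p.1.1 = 0 ∧ l ⬝ᵥ p.1.2 = 0) := by
  have hpos := add_pos_of_nonneg_of_pos (wedgeNormSq_nonneg u (contract l p.1.1 p.1.2))
    (wedgeNormSq_pos p.2)
  have h0 : wedgeNormSq u (contract l p.1.1 p.1.2) = 0 :=
    (div_eq_zero_iff.mp h).resolve_right hpos.ne'
  obtain ⟨c, hc⟩ := exists_eq_smul_of_wedgeNormSq_eq_zero h0 hu
  by_cases hc0 : c = 0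
  · right
    have := LinearIndependent.pair_iff.mp p.2 (-(l ⬝ᵥ p.1.2)) (l ⬝ᵥ p.1.1) (by
      rw [hc0, zero_smul, contract] at hc
      rw [← hc]
      module)
    exact ⟨this.2, neg_eq_zero.mp this.1⟩
  · left
    refine Submodule.mem_span_pair.mpr ⟨c⁻¹ * -(l ⬝ᵥ p.1.2), c⁻¹ * (l ⬝ᵥ p.1.1), ?_⟩
    rw [← inv_smul_smul₀ hc0 u, ← hc, contract]
    module

/-- A proper nonzero subspace and its orthogonal with respect to a nondegenerate form cannot cover
all the sums of two standard basis vectors. -/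
lemma exists_basis_sum_notMem {J : Matrix (Fin n) (Fin n) ℝ} (hJ : Function.Injective J.mulVec)
    (hn : 2 < n) (p : GrPair n) : ∃ i j : Fin n,
      (Pi.single i 1 + Pi.single j 1 : Fin n → ℝ) ∉ Submodule.span ℝ {p.1.1, p.1.2} ∧
      ¬ (((Pi.single i 1 + Pi.single j 1 : Fin n → ℝ) ᵥ* J) ⬝ᵥ p.1.1 = 0 ∧
        ((Pi.single i 1 + Pi.single j 1 : Fin n → ℝ) ᵥ* J) ⬝ᵥ p.1.2 = 0) := by
  set W := Submodule.span ℝ {p.1.1, p.1.2}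
  by_contra! H
  have hdouble (i : Fin n) : (Pi.single i 1 : Fin n → ℝ) ∉ W →
      (J *ᵥ p.1.1) i = 0 ∧ (J *ᵥ p.1.2) i = 0 := by
    intro hi
    have hi2 : (Pi.single i 1 + Pi.single i 1 : Fin n → ℝ) ∉ W := fun h => by
      rw [← two_smul ℝ] at h
      exact hi ((W.smul_mem_iff two_ne_zero).mp h)
    have := H i i hi2
    simpa [← dotProduct_mulVec, add_dotProduct] using this
  obtain ⟨i, hi⟩ : ∃ i, (Pi.single i 1 : Fin n → ℝ) ∉ W := by
    by_contra! h
    have htop : W = ⊤ := by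
      rw [eq_top_iff, ← (Pi.basisFun ℝ (Fin n)).span_eq, Submodule.span_le]
      rintro _ ⟨i, rfl⟩
      simpa using h i
    have hle : Module.finrank ℝ W ≤ 2 := by
      classical
      have := finrank_span_finset_le_card (R := ℝ) ({p.1.1, p.1.2} : Finset (Fin n → ℝ))
      simp only [Finset.coe_insert, Finset.coe_singleton] at this
      exact this.trans Finset.card_le_two
    rw [htop, finrank_top, Module.finrank_fin_fun] at hle
    omega
  obtain ⟨j, hj⟩ : ∃ j, (J *ᵥ p.1.1) j ≠ 0 := by
    by_contra! h
    have : p.1.1 = 0 := hJ (by rw [mulVec_zero]; exact funext h)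
    exact p.2.ne_zero 0 this
  have hjW : (Pi.single j 1 : Fin n → ℝ) ∈ W := by
    by_contra h
    exact hj (hdouble j h).1
  have hsum := (H i j fun h => hi ((W.add_mem_iff_left hjW).mp h)).1
  rw [← dotProduct_mulVec, add_dotProduct] at hsum
  simp [(hdouble i hi).1, hj] at hsum

end Invariance

lemma Jstd_transpose (d : ℕ) : (Jstd d)ᵀ = -Jstd d := by
  rw [Jstd, transpose_reindex, fromBlocks_transpose]
  ext i j
  simp only [reindex_apply, submatrix_apply, Matrix.neg_apply]
  rw [← Matrix.neg_apply, fromBlocks_neg]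
  simp

lemma Jstd_mulVec_injective (d : ℕ) : Function.Injective (Jstd d).mulVec := by
  refine mulVec_injective_iff_isUnit.mpr (IsUnit.of_mul_eq_one (-Jstd d) ?_)
  rw [mul_neg, Jstd, reindex_apply, submatrix_mul_equiv, fromBlocks_multiply]
  ext i j
  simp only [Matrix.neg_apply, submatrix_apply]
  rw [← Matrix.neg_apply, fromBlocks_neg]
  simp [Matrix.one_apply]

lemma vecMul_dotProduct_self_eq_zero {n : ℕ} {J : Matrix (Fin n) (Fin n) ℝ} (hJ : Jᵀ = -J)
    (u : Fin n → ℝ) : (u ᵥ* J) ⬝ᵥ u = 0 := by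
  have h : (u ᵥ* J) ⬝ᵥ u = -((u ᵥ* J) ⬝ᵥ u) := by
    conv_lhs => rw [← dotProduct_mulVec, ← vecMul_transpose, hJ, vecMul_neg, dotProduct_neg,
      dotProduct_comm]
  linarith

/-- for `d ≥ 2` there is no `Sp(2d,ℝ)`-invariant Borel probability measure on the
Grassmannian `Gr(ℝ^{2d}, 2)`, where a symplectic matrix `S` (i.e. `Sᵀ J S = J`) acts by
`V ↦ S·V`. (Every symplectic matrix is invertible, so the injectivity hypothesis `hinj` is
automatically satisfiable.) -/
theorem no_symplectic_invariant_measure_on_grassmannian (d : ℕ) (hd : 2 ≤ d) :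
    ¬ ∃ ν : Measure (Gr2 (d + d)), IsProbabilityMeasure ν ∧
      ∀ S : Matrix (Fin (d + d)) (Fin (d + d)) ℝ, Sᵀ * Jstd d * S = Jstd d →
        ∀ hinj : Function.Injective S.mulVecLin,
          Measure.map (grMap S hinj) ν = ν := by
  rintro ⟨ν, hprob, hν⟩
  have hself := vecMul_dotProduct_self_eq_zero (Jstd_transpose d)
  have hae : ∀ᵐ V ∂ν, ∀ i j : Fin (d + d),
      grRatio (Pi.single i 1 + Pi.single j 1) ((Pi.single i 1 + Pi.single j 1) ᵥ* Jstd d) V = 0 :=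
    ae_all_iff.mpr fun i => ae_all_iff.mpr fun j => ae_grRatio_eq_zero (hself _) fun t =>
      hν _ (transvectionMatrix_preserves (Jstd_transpose d) (hself _) t) _
  obtain ⟨V, hV⟩ := hae.exists
  induction V using Quotient.inductionOn with
  | h p =>
    obtain ⟨i, j, hmem, horth⟩ := exists_basis_sum_notMem (Jstd_mulVec_injective d) (by omega) p
    have hne : (Pi.single i 1 + Pi.single j 1 : Fin (d + d) → ℝ) ≠ 0 := fun h =>
      hmem (h ▸ Submodule.zero_mem _)
    exact (mem_span_or_of_pairRatio_eq_zero hne p (hV i j)).elim hmem horth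
end

section
/- Let d ≥ 2 and let ω be an alternating bilinear form on ℝ^d that takes integer values on ℤ^d × ℤ^d. Let V ⊆ ℝ^d be a 2-dimensional subspace such that ω restricted to V is nondegenerate, and such that V ∩ ℤ^d is a rank-2 subgroup spanning V over ℝ; let v₁, v₂ be a ℤ-basis of V ∩ ℤ^d and set D = ω(v₁, v₂), D ≠ 0. Define the linear map A : ℝ^d → ℝ^d by A(v) = ω(v, v₂) v₁ − ω(v, v₁) v₂. Then: (i) A maps ℤ^d into ℤ^d; (ii) A(w) = D·w for every w ∈ V; (iii) A(w) = 0 for every w ∈ ℝ^d with ω(w, V) = 0; and (iv) V = {w ∈ ℝ^d : A(w) = D·w}, i.e., V is exactly the D-eigenspace of A. -/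
/-- A vector in `ℝ^d` has integer coordinates, i.e. lies in `ℤ^d`. -/
def IsIntVec {d : ℕ} (v : Fin d → ℝ) : Prop := ∀ i, ∃ n : ℤ, v i = n

/-- given an alternating bilinear form `ω` on `ℝ^d` that is integral on `ℤ^d`, a
`2`-dimensional subspace `V` on which `ω` is nondegenerate and such that `V ∩ ℤ^d` is a rank-`2`
subgroup spanning `V`, with `ℤ`-basis `v₁, v₂` and `D = ω(v₁, v₂) ≠ 0`, the map
`A v = ω(v, v₂) v₁ - ω(v, v₁) v₂` is integral on `ℤ^d`, equals `D·Id` on `V`, vanishes on the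
`ω`-orthogonal complement of `V`, and `V` is exactly the `D`-eigenspace of `A`. -/
theorem eigenprojection_of_integral_symplectic_plane
    (d : ℕ) (hd : 2 ≤ d)
    (ω : (Fin d → ℝ) →ₗ[ℝ] (Fin d → ℝ) →ₗ[ℝ] ℝ)
    (hωalt : ∀ v, ω v v = 0)
    (hωint : ∀ v w : Fin d → ℝ, IsIntVec v → IsIntVec w → ∃ n : ℤ, ω v w = n)
    (V : Submodule ℝ (Fin d → ℝ)) (hVdim : Module.finrank ℝ V = 2)
    (hVnondeg : ∀ v ∈ V, (∀ w ∈ V, ω v w = 0) → v = 0)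
    (v₁ v₂ : Fin d → ℝ) (hv₁V : v₁ ∈ V) (hv₂V : v₂ ∈ V)
    (hv₁int : IsIntVec v₁) (hv₂int : IsIntVec v₂)
    (hspan : Submodule.span ℝ {v₁, v₂} = V)
    (hbasis : ∀ w ∈ V, IsIntVec w → ∃ a b : ℤ, w = a • v₁ + b • v₂)
    (D : ℝ) (hD : D = ω v₁ v₂) (hD0 : D ≠ 0)
    (A : (Fin d → ℝ) → (Fin d → ℝ))
    (hA : A = fun v => ω v v₂ • v₁ - ω v v₁ • v₂) :
    (∀ v : Fin d → ℝ, IsIntVec v → IsIntVec (A v)) ∧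
      (∀ w ∈ V, A w = D • w) ∧
      (∀ w : Fin d → ℝ, (∀ v ∈ V, ω w v = 0) → A w = 0) ∧
      ((V : Set (Fin d → ℝ)) = {w | A w = D • w}) := by
  have hω₂₁ : ω v₂ v₁ = -ω v₁ v₂ := by
    rw [← LinearMap.IsAlt.neg hωalt v₁ v₂]
  have hAV : ∀ w ∈ V, A w = D • w := by
    intro w hw
    rw [← hspan, Submodule.mem_span_pair] at hw
    obtain ⟨a, b, rfl⟩ := hw
    simp only [hA, hD, map_add, map_smul, LinearMap.add_apply, LinearMap.smul_apply, hωalt,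
      hω₂₁, smul_eq_mul]
    module
  refine ⟨fun v hv i => ?_, hAV, fun w hw => ?_, ?_⟩
  · obtain ⟨m, hm⟩ := hωint v v₂ hv hv₂int
    obtain ⟨n, hn⟩ := hωint v v₁ hv hv₁int
    obtain ⟨p, hp⟩ := hv₁int i
    obtain ⟨q, hq⟩ := hv₂int i
    exact ⟨m * p - n * q, by simp [hA, hm, hn, hp, hq]⟩
  · simp [hA, hw v₁ hv₁V, hw v₂ hv₂V]
  · refine Set.Subset.antisymm hAV fun w (hw : A w = D • w) => ?_
    have hAw : A w ∈ V := by
      rw [hA]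
      exact V.sub_mem (V.smul_mem _ hv₁V) (V.smul_mem _ hv₂V)
    rw [hw] at hAw
    exact (V.smul_mem_iff hD0).mp hAw
end

section
/- Let d ≥ 2, let ω be an alternating bilinear form on ℝ^d taking integer values on ℤ^d × ℤ^d, and let D ≥ 1 be an integer. Let U_ω = {V ∈ Gr(ℝ^d, 2) : ω restricted to V is nondegenerate}, and let U_ω(ℤ, D) be the set of V ∈ U_ω such that V ∩ ℤ^d is a rank-2 subgroup spanning V over ℝ and |ω(v₁, v₂)| = D for a ℤ-basis v₁, v₂ of V ∩ ℤ^d. Then U_ω(ℤ, D) is closed and discrete in U_ω: every point of U_ω has an open neighborhood in U_ω meeting U_ω(ℤ, D) in at most one point. -/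
open MeasureTheory Matrix

/-- `ω` restricted to the plane `W` is nondegenerate. -/
def NondegOn {d : ℕ} (ω : (Fin d → ℝ) →ₗ[ℝ] (Fin d → ℝ) →ₗ[ℝ] ℝ)
    (W : Submodule ℝ (Fin d → ℝ)) : Prop :=
  ∀ v ∈ W, (∀ w ∈ W, ω v w = 0) → v = 0

/-- Membership in `U_ω(ℤ, D)`: the plane of `V` meets `ℤ^d` in a rank-`2` subgroup spanning it,
with a `ℤ`-basis `v₁, v₂` satisfying `|ω(v₁, v₂)| = D`. -/
def IsDIntegralPlane {d : ℕ} (ω : (Fin d → ℝ) →ₗ[ℝ] (Fin d → ℝ) →ₗ[ℝ] ℝ) (D : ℤ)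
    (V : Gr2 d) : Prop :=
  ∃ v₁ v₂ : Fin d → ℝ,
    v₁ ∈ V.toSubmodule ∧ v₂ ∈ V.toSubmodule ∧ IsIntVec v₁ ∧ IsIntVec v₂ ∧
    Submodule.span ℝ {v₁, v₂} = V.toSubmodule ∧
    (∀ w ∈ V.toSubmodule, IsIntVec w → ∃ a b : ℤ, w = a • v₁ + b • v₂) ∧
    |ω v₁ v₂| = (D : ℝ)

section PlaneProjection

variable {E : Type*} [AddCommGroup E] [Module ℝ E]

/-- The projection onto the plane spanned by `v, w` along its `ω`-orthogonal complement
(meaningful when `ω v w ≠ 0`). -/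
noncomputable def planeProj (ω : E →ₗ[ℝ] E →ₗ[ℝ] ℝ) (v w : E) : E →ₗ[ℝ] E :=
  (ω v w)⁻¹ • ((ω.flip w).smulRight v - (ω.flip v).smulRight w)

variable {ω : E →ₗ[ℝ] E →ₗ[ℝ] ℝ} {v w : E}

lemma planeProj_apply (x : E) :
    planeProj ω v w x = (ω v w)⁻¹ • (ω x w • v - ω x v • w) := rfl

lemma planeProj_mem (x : E) : planeProj ω v w x ∈ Submodule.span ℝ {v, w} := by
  refine Submodule.smul_mem _ _ (Submodule.sub_mem _ ?_ ?_) <;>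
    exact Submodule.smul_mem _ _ (Submodule.subset_span (by simp))

lemma neg_apply_swap (hω : ∀ v, ω v v = 0) (v w : E) : ω w v = -ω v w := by
  have h := hω (v + w)
  simp only [map_add, LinearMap.add_apply, hω] at h
  linarith

lemma apply_sub_planeProj (hω : ∀ v, ω v v = 0) (h : ω v w ≠ 0) (x : E) {z : E}
    (hz : z ∈ Submodule.span ℝ {v, w}) : ω (x - planeProj ω v w x) z = 0 := by
  obtain ⟨a, b, rfl⟩ := Submodule.mem_span_pair.1 hz
  simp only [planeProj_apply, map_sub, map_smul, map_add, LinearMap.sub_apply,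
    LinearMap.smul_apply, smul_eq_mul, hω, neg_apply_swap hω v w]
  field_simp
  ring

end PlaneProjection

section Plane

variable {d : ℕ} {ω : (Fin d → ℝ) →ₗ[ℝ] (Fin d → ℝ) →ₗ[ℝ] ℝ} {v w : Fin d → ℝ}

lemma nondegOn_span_pair (hω : ∀ v, ω v v = 0) (h : ω v w ≠ 0) :
    NondegOn ω (Submodule.span ℝ {v, w}) := by
  intro x hx hx0
  obtain ⟨a, b, rfl⟩ := Submodule.mem_span_pair.1 hx
  have h1 := hx0 v (Submodule.subset_span (by simp))
  have h2 := hx0 w (Submodule.subset_span (by simp))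
  simp only [map_add, map_smul, LinearMap.add_apply, LinearMap.smul_apply, smul_eq_mul, hω,
    neg_apply_swap hω v w] at h1 h2
  have ha : a = 0 := by simpa [h] using h2
  have hb : b = 0 := by simpa [h] using h1
  simp [ha, hb]

lemma nondegOn_span_pair_iff (hω : ∀ v, ω v v = 0) (hv : v ≠ 0) :
    NondegOn ω (Submodule.span ℝ {v, w}) ↔ ω v w ≠ 0 := by
  refine ⟨fun h h0 => hv (h v (Submodule.subset_span (by simp)) fun z hz => ?_),
    nondegOn_span_pair hω⟩
  obtain ⟨a, b, rfl⟩ := Submodule.mem_span_pair.1 hz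
  simp [hω, h0]

lemma eq_planeProj (hω : ∀ v, ω v v = 0) (h : ω v w ≠ 0) {x y : Fin d → ℝ}
    (hy : y ∈ Submodule.span ℝ {v, w})
    (hxy : ∀ z ∈ Submodule.span ℝ {v, w}, ω (x - y) z = 0) : y = planeProj ω v w x := by
  refine sub_eq_zero.1 (nondegOn_span_pair hω h _ (Submodule.sub_mem _ hy (planeProj_mem x)) ?_)
  intro z hz
  have h1 := hxy z hz
  have h2 := apply_sub_planeProj hω h x hz
  simp only [map_sub, LinearMap.sub_apply] at h1 h2 ⊢
  linarith

lemma planeProj_eq_self (hω : ∀ v, ω v v = 0) (h : ω v w ≠ 0) {x : Fin d → ℝ}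
    (hx : x ∈ Submodule.span ℝ {v, w}) : planeProj ω v w x = x :=
  (eq_planeProj hω h hx (by simp)).symm

lemma exists_int_mul_planeProj
    (hint : ∀ v w : Fin d → ℝ, IsIntVec v → IsIntVec w → ∃ n : ℤ, ω v w = n)
    {D : ℤ} (hD : |ω v w| = D) (h : ω v w ≠ 0) (hv : IsIntVec v) (hw : IsIntVec w)
    {x : Fin d → ℝ} (hx : IsIntVec x) (i : Fin d) :
    ∃ n : ℤ, (D : ℝ) * planeProj ω v w x i = n := by
  obtain ⟨a, ha⟩ := hint x w hx hw
  obtain ⟨b, hb⟩ := hint x v hx hv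
  obtain ⟨p, hp⟩ := hv i
  obtain ⟨q, hq⟩ := hw i
  have key : ω v w * planeProj ω v w x i = ((a * p - b * q : ℤ) : ℝ) := by
    simp [planeProj_apply, ha, hb, hp, hq, h]
  rcases abs_choice (ω v w) with h' | h' <;> rw [← hD, h']
  · exact ⟨_, key⟩
  · exact ⟨-(a * p - b * q), by rw [neg_mul, key, Int.cast_neg]⟩

lemma Gr2.toSubmodule_injective {n : ℕ} :
    Function.Injective (Gr2.toSubmodule : Gr2 n → Submodule ℝ (Fin n → ℝ)) := by
  rintro ⟨p⟩ ⟨q⟩ h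
  exact Quotient.sound h

lemma GrPair.fst_ne_zero {n : ℕ} (p : GrPair n) : p.1.1 ≠ 0 := p.2.ne_zero 0

lemma isIntVec_single (k : Fin d) : IsIntVec (Pi.single k (1 : ℝ)) := fun i =>
  ⟨(Pi.single k (1 : ℤ) : Fin d → ℤ) i, by by_cases h : i = k <;> simp [h]⟩

variable (ω) in
/-- The planes on which `ω` is nondegenerate and whose `ω`-orthogonal projection has matrix
coefficients within `ε` of `a`. -/
def projNhd (a : Fin d → Fin d → ℝ) (ε : ℝ) : Set (Gr2 d) :=
  {W | NondegOn ω W.toSubmodule ∧ ∀ k, ∃ y ∈ W.toSubmodule,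
    (∀ z ∈ W.toSubmodule, ω (Pi.single k 1 - y) z = 0) ∧ ∀ i, |y i - a k i| < ε}

lemma mk_mem_projNhd (hω : ∀ v, ω v v = 0) (a : Fin d → Fin d → ℝ) (ε : ℝ) (p : GrPair d) :
    (Quotient.mk (grSetoid d) p : Gr2 d) ∈ projNhd ω a ε ↔ ω p.1.1 p.1.2 ≠ 0 ∧
      ∀ k i, |planeProj ω p.1.1 p.1.2 (Pi.single k 1) i - a k i| < ε := by
  refine (and_congr_left' (nondegOn_span_pair_iff hω p.fst_ne_zero)).trans
    (and_congr_right fun h => forall_congr' fun k => ⟨?_, fun hk => ?_⟩)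
  · rintro ⟨y, hy, hyz, hya⟩
    rwa [← eq_planeProj hω h hy hyz]
  · exact ⟨_, planeProj_mem _, fun z hz => apply_sub_planeProj hω h _ hz, hk⟩

lemma isOpen_projNhd (hω : ∀ v, ω v v = 0) (a : Fin d → Fin d → ℝ) (ε : ℝ) :
    IsOpen (projNhd ω a ε) := by
  have hcont : ∀ f g : GrPair d → (Fin d → ℝ), Continuous f → Continuous g →
      Continuous fun p => ω (f p) (g p) := by
    intro f g hf hg
    let Ω : (Fin d → ℝ) →L[ℝ] (Fin d → ℝ) →L[ℝ] ℝ :=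
      LinearMap.toContinuousLinearMap (LinearMap.toContinuousLinearMap.toLinearMap ∘ₗ ω)
    exact (Ω.continuous.comp hf).clm_apply hg
  have hfst : Continuous fun p : GrPair d => p.1.1 := by fun_prop
  have hsnd : Continuous fun p : GrPair d => p.1.2 := by fun_prop
  refine isOpen_coinduced.2 ?_
  rw [isOpen_iff_mem_nhds]
  intro p hp
  obtain ⟨h0, hp⟩ := (mk_mem_projNhd hω a ε p).1 hp
  have hne := (hcont _ _ hfst hsnd).continuousAt.eventually_ne h0
  have hclose : ∀ k i, ∀ᶠ q : GrPair d in nhds p,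
      |planeProj ω q.1.1 q.1.2 (Pi.single k 1) i - a k i| < ε := by
    intro k i
    refine ContinuousAt.eventually_lt ?_ continuousAt_const (hp k i)
    simp only [planeProj_apply, Pi.smul_apply, Pi.sub_apply, smul_eq_mul]
    have h1 := (hcont _ _ hfst hsnd).continuousAt (x := p)
    have h2 := (hcont _ _ (continuous_const (y := Pi.single k 1)) hsnd).continuousAt (x := p)
    have h3 := (hcont _ _ (continuous_const (y := Pi.single k 1)) hfst).continuousAt (x := p)
    have h4 : ContinuousAt (fun q : GrPair d => q.1.1 i) p := by fun_prop
    have h5 : ContinuousAt (fun q : GrPair d => q.1.2 i) p := by fun_prop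
    exact (((h1.inv₀ h0).mul ((h2.mul h4).sub (h3.mul h5))).sub continuousAt_const).abs
  filter_upwards [hne, Filter.eventually_all.2 fun k => Filter.eventually_all.2 (hclose k)]
    with q hq hq'
  exact (mk_mem_projNhd hω a ε q).2 ⟨hq, hq'⟩

lemma planeProj_eq_of_close
    (hint : ∀ v w : Fin d → ℝ, IsIntVec v → IsIntVec w → ∃ n : ℤ, ω v w = n)
    {D : ℤ} (hD : 1 ≤ D) {v' w' : Fin d → ℝ} (hvw : |ω v w| = D) (hvw' : |ω v' w'| = D)
    (h : ω v w ≠ 0) (h' : ω v' w' ≠ 0)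
    (hv : IsIntVec v) (hw : IsIntVec w) (hv' : IsIntVec v') (hw' : IsIntVec w')
    {a : Fin d → Fin d → ℝ}
    (ha : ∀ k i, |planeProj ω v w (Pi.single k 1) i - a k i| < 1 / (2 * D))
    (ha' : ∀ k i, |planeProj ω v' w' (Pi.single k 1) i - a k i| < 1 / (2 * D)) :
    planeProj ω v w = planeProj ω v' w' := by
  refine (Pi.basisFun ℝ (Fin d)).ext fun k => funext fun i => ?_
  rw [Pi.basisFun_apply]
  obtain ⟨m, hm⟩ := exists_int_mul_planeProj hint hvw h hv hw (isIntVec_single k) i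
  obtain ⟨n, hn⟩ := exists_int_mul_planeProj hint hvw' h' hv' hw' (isIntVec_single k) i
  have hD0 : (0 : ℝ) < D := by exact_mod_cast hD
  have hlt : |planeProj ω v w (Pi.single k 1) i - planeProj ω v' w' (Pi.single k 1) i|
      < 1 / D := by
    refine (abs_sub_le _ (a k i) _).trans_lt ?_
    rw [abs_sub_comm (a k i)]
    have : (1 : ℝ) / D = 1 / (2 * D) + 1 / (2 * D) := by field_simp; norm_num
    linarith [ha k i, ha' k i]
  have hmn : |((m - n : ℤ) : ℝ)| < 1 := by
    rw [Int.cast_sub, ← hm, ← hn, ← mul_sub, abs_mul, abs_of_pos hD0]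
    calc _ < (D : ℝ) * (1 / D) := by gcongr
      _ = 1 := by field_simp
  have hmn' : m = n := sub_eq_zero.1 (Int.abs_lt_one_iff.1 (by exact_mod_cast hmn))
  exact mul_left_cancel₀ hD0.ne' (by rw [hm, hn, hmn'])

end Plane

/-- for an alternating bilinear form `ω` on `ℝ^d` that is integral on `ℤ^d` and an
integer `D ≥ 1`, the set `U_ω(ℤ, D)` is closed and discrete in
`U_ω = {V ∈ Gr(ℝ^d, 2) : ω|_V nondegenerate}`: every point of `U_ω` has an open neighborhood
meeting `U_ω(ℤ, D) ⊆ U_ω` in at most one point. -/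
theorem integral_planes_discrete
    (d : ℕ) (hd : 2 ≤ d)
    (ω : (Fin d → ℝ) →ₗ[ℝ] (Fin d → ℝ) →ₗ[ℝ] ℝ)
    (hωalt : ∀ v, ω v v = 0)
    (hωint : ∀ v w : Fin d → ℝ, IsIntVec v → IsIntVec w → ∃ n : ℤ, ω v w = n)
    (D : ℤ) (hD : 1 ≤ D) :
    ∀ V : Gr2 d, NondegOn ω V.toSubmodule →
      ∃ O : Set (Gr2 d), IsOpen O ∧ V ∈ O ∧
        Set.Subsingleton
          {W ∈ O | NondegOn ω W.toSubmodule ∧ IsDIntegralPlane ω D W} := by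
  rintro ⟨p⟩ hV
  have h0 := (nondegOn_span_pair_iff hωalt p.fst_ne_zero).1 hV
  have hD0 : (0 : ℝ) < D := by exact_mod_cast hD
  let a : Fin d → Fin d → ℝ := fun k => planeProj ω p.1.1 p.1.2 (Pi.single k 1)
  refine ⟨projNhd ω a (1 / (2 * D)), isOpen_projNhd hωalt _ _,
    (mk_mem_projNhd hωalt _ _ p).2 ⟨h0, fun k i => by simp [a, hD0]⟩, ?_⟩
  rintro W ⟨⟨-, hWa⟩, -, v, w, -, -, hv, hw, hs, -, hvw⟩
    W' ⟨⟨-, hWa'⟩, -, v', w', -, -, hv', hw', hs', -, hvw'⟩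
  have h : ω v w ≠ 0 := abs_pos.1 (hvw ▸ hD0)
  have h' : ω v' w' ≠ 0 := abs_pos.1 (hvw' ▸ hD0)
  rw [← hs] at hWa
  rw [← hs'] at hWa'
  have hP : planeProj ω v w = planeProj ω v' w' := by
    refine planeProj_eq_of_close hωint hD hvw hvw' h h' hv hw hv' hw' (a := a)
      (fun k => ?_) (fun k => ?_)
    · obtain ⟨y, hy, hyz, hya⟩ := hWa k
      rwa [← eq_planeProj hωalt h hy hyz]
    · obtain ⟨y, hy, hyz, hya⟩ := hWa' k
      rwa [← eq_planeProj hωalt h' hy hyz]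
  refine Gr2.toSubmodule_injective ?_
  rw [← hs, ← hs']
  refine le_antisymm (fun x hx => ?_) (fun x hx => ?_)
  · rw [← planeProj_eq_self hωalt h hx, hP]
    exact planeProj_mem x
  · rw [← planeProj_eq_self hωalt h' hx, ← hP]
    exact planeProj_mem x
end
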